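/- arXiv:1911.02254 — 2 statements merged into one kernel-verified Lean document; each statement's English description precedes it below -/
import Mathlib

section
/- Let p1, p2, p3, p4 ∈ (0, 1), set p5 = p1(p3 - p4) + p4 and p6 = p2(p3 - p4) + p4, and assume p5 ≠ p6. Then the two-stage randomized response M'' with parameters (p1, p2, p3, p4) satisfies ε1-local differential privacy with ε1 = ln(max(p5/p6, p6/p5, (1 - p5)/(1 - p6), (1 - p6)/(1 - p5))). -/
/-- Lemma 2: the two-stage randomized response with parameters `(p1, p2, p3, p4)`
(first `RR(p1, p2)`, then independently `RR(p3, p4)` applied to the memoized answer)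
satisfies `ε1`-local differential privacy with
`ε1 = ln(max(p5/p6, p6/p5, (1-p5)/(1-p6), (1-p6)/(1-p5)))`, where
`p5 = p1(p3 - p4) + p4` and `p6 = p2(p3 - p4) + p4`. -/
theorem stmt2 (p1 p2 p3 p4 : ℝ)
    (hp10 : 0 < p1) (hp11 : p1 < 1) (hp20 : 0 < p2) (hp21 : p2 < 1)
    (hp30 : 0 < p3) (hp31 : p3 < 1) (hp40 : 0 < p4) (hp41 : p4 < 1)
    (p5 p6 : ℝ) (hp5 : p5 = p1 * (p3 - p4) + p4) (hp6 : p6 = p2 * (p3 - p4) + p4)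
    (hne : p5 ≠ p6)
    (M1 M2 M'' : Bool → Bool → ℝ)
    (hM1tt : M1 true true = p1) (hM1ft : M1 false true = p2)
    (hM1c : ∀ x, M1 x false = 1 - M1 x true)
    (hM2tt : M2 true true = p3) (hM2ft : M2 false true = p4)
    (hM2c : ∀ x, M2 x false = 1 - M2 x true)
    (hcomp : ∀ x z, M'' x z = M1 x true * M2 true z + M1 x false * M2 false z)
    (ε1 : ℝ)
    (hε : ε1 = Real.log (max (max (p5 / p6) (p6 / p5))
      (max ((1 - p5) / (1 - p6)) ((1 - p6) / (1 - p5))))) :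
    ∀ x y z : Bool, M'' x z ≤ Real.exp ε1 * M'' y z := by
  have key : ∀ a b c d : ℝ, 0 < a → a < 1 → 0 < c → c < 1 → 0 < d → d < 1 →
      b = a * (c - d) + d → 0 < b ∧ b < 1 := by
    intro a b c d ha ha1 hc hc1 hd hd1 hb
    have h1 := mul_pos ha hc
    have h2 := mul_pos (sub_pos.2 ha1) hd
    have h3 := mul_pos ha (sub_pos.2 hc1)
    have h4 := mul_pos (sub_pos.2 ha1) (sub_pos.2 hd1)
    constructor <;> nlinarith
  obtain ⟨h50, h51⟩ := key p1 p5 p3 p4 hp10 hp11 hp30 hp31 hp40 hp41 hp5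
  obtain ⟨h60, h61⟩ := key p2 p6 p3 p4 hp20 hp21 hp30 hp31 hp40 hp41 hp6
  have h52 : 0 < 1 - p5 := sub_pos.2 h51
  have h62 : 0 < 1 - p6 := sub_pos.2 h61
  have ett : M'' true true = p5 := by
    rw [hcomp, hM1c, hM1tt, hM2tt, hM2ft, hp5]; ring
  have eft : M'' false true = p6 := by
    rw [hcomp, hM1c, hM1ft, hM2tt, hM2ft, hp6]; ring
  have etf : M'' true false = 1 - p5 := by
    rw [hcomp, hM1c, hM2c, hM2c, hM1tt, hM2tt, hM2ft, hp5]; ring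
  have eff : M'' false false = 1 - p6 := by
    rw [hcomp, hM1c, hM2c, hM2c, hM1ft, hM2tt, hM2ft, hp6]; ring
  set m := max (max (p5 / p6) (p6 / p5))
      (max ((1 - p5) / (1 - p6)) ((1 - p6) / (1 - p5))) with hm
  have a1 : p5 / p6 ≤ m := by simp [hm]
  have a2 : p6 / p5 ≤ m := by simp [hm]
  have a3 : (1 - p5) / (1 - p6) ≤ m := by simp [hm]
  have a4 : (1 - p6) / (1 - p5) ≤ m := by simp [hm]
  have hm0 : 0 < m := lt_of_lt_of_le (div_pos h50 h60) a1
  rw [div_le_iff₀ h60] at a1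
  rw [div_le_iff₀ h50] at a2
  rw [div_le_iff₀ h62] at a3
  rw [div_le_iff₀ h52] at a4
  have hm1 : 1 ≤ m := by
    by_contra h
    push Not at h
    have := mul_lt_mul_of_pos_right h h50
    have := mul_lt_mul_of_pos_right h h60
    linarith
  have b1 := mul_le_mul_of_nonneg_right hm1 h50.le
  have b2 := mul_le_mul_of_nonneg_right hm1 h60.le
  have b3 := mul_le_mul_of_nonneg_right hm1 h52.le
  have b4 := mul_le_mul_of_nonneg_right hm1 h62.le
  rw [one_mul] at b1 b2 b3 b4
  rw [hε, Real.exp_log hm0]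
  intro x y z
  cases x <;> cases y <;> cases z <;> simp only [ett, eft, etf, eff] <;> assumption
end

section
/- Let p1, p2, p3, p4 ∈ (0, 1) and set p5 = p1(p3 - p4) + p4 and p6 = p2(p3 - p4) + p4. Then max(p5/p6, p6/p5, (1 - p5)/(1 - p6), (1 - p6)/(1 - p5)) ≤ max(p1/p2, p2/p1, (1 - p1)/(1 - p2), (1 - p2)/(1 - p1)); equivalently, the privacy level ε1 of the one-time instantaneous randomized response is at most the privacy level ε∞ of the permanent randomized response. -/
/-- Theorem 1 (core inequality): with `p5 = p1(p3 - p4) + p4` and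
`p6 = p2(p3 - p4) + p4`, the privacy level of the one-time instantaneous
randomized response is at most that of the permanent randomized response:
`max(p5/p6, p6/p5, (1-p5)/(1-p6), (1-p6)/(1-p5))
  ≤ max(p1/p2, p2/p1, (1-p1)/(1-p2), (1-p2)/(1-p1))`;
equivalently (taking logarithms) `ε1 ≤ ε∞`. -/
theorem stmt3 (p1 p2 p3 p4 : ℝ)
    (hp10 : 0 < p1) (hp11 : p1 < 1) (hp20 : 0 < p2) (hp21 : p2 < 1)
    (hp30 : 0 < p3) (hp31 : p3 < 1) (hp40 : 0 < p4) (hp41 : p4 < 1)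
    (p5 p6 : ℝ) (hp5 : p5 = p1 * (p3 - p4) + p4) (hp6 : p6 = p2 * (p3 - p4) + p4) :
    max (max (p5 / p6) (p6 / p5)) (max ((1 - p5) / (1 - p6)) ((1 - p6) / (1 - p5)))
      ≤ max (max (p1 / p2) (p2 / p1)) (max ((1 - p1) / (1 - p2)) ((1 - p2) / (1 - p1))) ∧
    Real.log (max (max (p5 / p6) (p6 / p5)) (max ((1 - p5) / (1 - p6)) ((1 - p6) / (1 - p5))))
      ≤ Real.log (max (max (p1 / p2) (p2 / p1))
          (max ((1 - p1) / (1 - p2)) ((1 - p2) / (1 - p1)))) := by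
  have key : max (max (p5 / p6) (p6 / p5)) (max ((1 - p5) / (1 - p6)) ((1 - p6) / (1 - p5)))
      ≤ max (max (p1 / p2) (p2 / p1)) (max ((1 - p1) / (1 - p2)) ((1 - p2) / (1 - p1))) := by
    have mix : ∀ a b c d M : ℝ, 0 < c → 0 < d → a ≤ M * b → 1 - a ≤ M * (1 - b) →
        a * c + (1 - a) * d ≤ M * (b * c + (1 - b) * d) := by
      intro a b c d M hc hd h1 h2
      have e1 := mul_le_mul_of_nonneg_right h1 hc.le
      have e2 := mul_le_mul_of_nonneg_right h2 hd.le
      linarith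
    have pos : ∀ a c d : ℝ, 0 < a → a < 1 → 0 < c → 0 < d → 0 < a * c + (1 - a) * d := by
      intro a c d h0 h1 hc hd
      have := mul_pos h0 hc
      have := mul_pos (sub_pos.2 h1) hd
      linarith
    have e5 : p5 = p1 * p3 + (1 - p1) * p4 := by rw [hp5]; ring
    have e6 : p6 = p2 * p3 + (1 - p2) * p4 := by rw [hp6]; ring
    have f5 : 1 - p5 = p1 * (1 - p3) + (1 - p1) * (1 - p4) := by rw [hp5]; ring
    have f6 : 1 - p6 = p2 * (1 - p3) + (1 - p2) * (1 - p4) := by rw [hp6]; ring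
    have q3 := sub_pos.2 hp31
    have q4 := sub_pos.2 hp41
    generalize hM : max (max (p1 / p2) (p2 / p1))
      (max ((1 - p1) / (1 - p2)) ((1 - p2) / (1 - p1))) = M
    have hle := hM.le
    simp only [max_le_iff] at hle
    obtain ⟨⟨h1, h2⟩, h3, h4⟩ := hle
    rw [div_le_iff₀ (by linarith)] at h1 h2 h3 h4
    rw [f5, f6, e5, e6]
    refine max_le (max_le ?_ ?_) (max_le ?_ ?_)
    · rw [div_le_iff₀ (pos _ _ _ hp20 hp21 hp30 hp40)]
      exact mix _ _ _ _ _ hp30 hp40 h1 h3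
    · rw [div_le_iff₀ (pos _ _ _ hp10 hp11 hp30 hp40)]
      exact mix _ _ _ _ _ hp30 hp40 h2 h4
    · rw [div_le_iff₀ (pos _ _ _ hp20 hp21 q3 q4)]
      exact mix _ _ _ _ _ q3 q4 h1 h3
    · rw [div_le_iff₀ (pos _ _ _ hp10 hp11 q3 q4)]
      exact mix _ _ _ _ _ q3 q4 h2 h4
  refine ⟨key, Real.log_le_log ?_ key⟩
  have h5 : 0 < p5 := by rw [hp5]; nlinarith [mul_pos hp10 hp30, mul_pos (sub_pos.2 hp11) hp40]
  have h6 : 0 < p6 := by rw [hp6]; nlinarith [mul_pos hp20 hp30, mul_pos (sub_pos.2 hp21) hp40]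
  exact lt_of_lt_of_le (div_pos h5 h6) ((le_max_left _ _).trans (le_max_left _ _))
end
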